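/- arXiv:1509.08208 — 3 statements merged into one kernel-verified Lean document; each statement's English description precedes it below -/
import Mathlib

section
/- Let k ≥ 1 and let G be a finite simple graph with minimum degree δ(G) ≥ k. Then γ_{×k,t}(G) ≥ k · ρ(G), where ρ(G) is the packing number of G. -/
open SimpleGraph Set

/-- `S` is a `k`-tuple total dominating set (kTDS) of `G`: every vertex of `G`
has at least `k` neighbors in `S`. -/
def IsKTDS {V : Type*} (G : SimpleGraph V) (k : ℕ) (S : Set V) : Prop :=
  ∀ v : V, k ≤ (S ∩ G.neighborSet v).ncard

/-- The `k`-tuple total domination number `γ_{×k,t}(G)`: the minimum cardinality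
of a `k`-tuple total dominating set of `G`. -/
noncomputable def kTotalDomNum {V : Type*} [Fintype V] (G : SimpleGraph V) (k : ℕ) : ℕ :=
  sInf {n : ℕ | ∃ S : Set V, IsKTDS G k S ∧ S.ncard = n}

/-- A packing of `G`: a set of vertices whose closed neighborhoods are pairwise disjoint. -/
def IsPacking {V : Type*} (G : SimpleGraph V) (S : Set V) : Prop :=
  S.Pairwise fun u v => Disjoint (insert u (G.neighborSet u)) (insert v (G.neighborSet v))

/-- The packing number `ρ(G)`: the maximum cardinality of a packing of `G`. -/
noncomputable def packingNum {V : Type*} [Fintype V] (G : SimpleGraph V) : ℕ :=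
  sSup {n : ℕ | ∃ S : Set V, IsPacking G S ∧ S.ncard = n}

/-- An open packing of `G`: a set of vertices whose open neighborhoods are pairwise disjoint. -/
def IsOpenPacking {V : Type*} (G : SimpleGraph V) (S : Set V) : Prop :=
  S.Pairwise fun u v => Disjoint (G.neighborSet u) (G.neighborSet v)

/-- The open packing number `ρ^open(G)`: the maximum cardinality of an open packing of `G`. -/
noncomputable def openPackingNum {V : Type*} [Fintype V] (G : SimpleGraph V) : ℕ :=
  sSup {n : ℕ | ∃ S : Set V, IsOpenPacking G S ∧ S.ncard = n}

theorem IsPacking.isOpenPacking {V : Type*} {G : SimpleGraph V} {P : Set V}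
    (hP : IsPacking G P) : IsOpenPacking G P :=
  hP.mono' fun _ _ h => h.mono (subset_insert _ _) (subset_insert _ _)

theorem IsOpenPacking.mul_ncard_le {V : Type*} [Finite V] {G : SimpleGraph V} {k : ℕ}
    {P S : Set V} (hP : IsOpenPacking G P) (hS : IsKTDS G k S) : k * P.ncard ≤ S.ncard := by
  classical
  have := Fintype.ofFinite V
  have hdisj : (P.toFinset : Set V).PairwiseDisjoint
      fun v => (S ∩ G.neighborSet v).toFinset := by
    intro u hu v hv huv
    rw [Set.coe_toFinset] at hu hv
    exact Set.disjoint_toFinset.2 ((hP hu hv huv).mono inter_subset_right inter_subset_right)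
  have hsub : (P.toFinset.biUnion fun v => (S ∩ G.neighborSet v).toFinset) ⊆ S.toFinset :=
    Finset.biUnion_subset.2 fun _ _ => Set.toFinset_subset_toFinset.2 inter_subset_left
  calc k * P.ncard = ∑ _v ∈ P.toFinset, k := by
        rw [Finset.sum_const, smul_eq_mul, mul_comm, Set.ncard_eq_toFinset_card']
    _ ≤ ∑ v ∈ P.toFinset, (S ∩ G.neighborSet v).toFinset.card :=
        Finset.sum_le_sum fun v _ => by simpa only [Set.ncard_eq_toFinset_card'] using hS v
    _ = (P.toFinset.biUnion fun v => (S ∩ G.neighborSet v).toFinset).card :=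
        (Finset.card_biUnion hdisj).symm
    _ ≤ S.toFinset.card := Finset.card_le_card hsub
    _ = S.ncard := (Set.ncard_eq_toFinset_card' S).symm

theorem exists_isPacking_ncard_eq_packingNum {V : Type*} [Fintype V] (G : SimpleGraph V) :
    ∃ P : Set V, IsPacking G P ∧ P.ncard = packingNum G := by
  refine Nat.sSup_mem (s := {n : ℕ | ∃ P : Set V, IsPacking G P ∧ P.ncard = n})
    ⟨0, ∅, Set.pairwise_empty _, Set.ncard_empty V⟩ ⟨(Set.univ : Set V).ncard, ?_⟩
  rintro _ ⟨P, -, rfl⟩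
  exact Set.ncard_le_ncard P.subset_univ

theorem exists_isKTDS_ncard_eq_kTotalDomNum {V : Type*} [Fintype V] (G : SimpleGraph V)
    (k : ℕ) (hδ : ∀ v : V, k ≤ (G.neighborSet v).ncard) :
    ∃ S : Set V, IsKTDS G k S ∧ S.ncard = kTotalDomNum G k :=
  Nat.sInf_mem (s := {n : ℕ | ∃ S : Set V, IsKTDS G k S ∧ S.ncard = n})
    ⟨_, Set.univ, fun v => by simpa using hδ v, rfl⟩

theorem ktdn_ge_k_mul_packingNum {V : Type*} [Fintype V] (G : SimpleGraph V)
    (k : ℕ) (hk : 1 ≤ k) (hδ : ∀ v : V, k ≤ (G.neighborSet v).ncard) :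
    k * packingNum G ≤ kTotalDomNum G k := by
  obtain ⟨P, hP, hPcard⟩ := exists_isPacking_ncard_eq_packingNum G
  obtain ⟨S, hS, hScard⟩ := exists_isKTDS_ncard_eq_kTotalDomNum G k hδ
  rw [← hPcard, ← hScard]
  exact hP.isOpenPacking.mul_ncard_le hS
end

section
/- Let k ≥ 1 and let n, m be integers with m ≥ n ≥ 2 and m ≥ k. Then γ_{×k,t}(K_n □ K_m) ≤ k·n. -/
open SimpleGraph Set

theorem kTotalDomNum_le_ncard {V : Type*} [Fintype V] {G : SimpleGraph V} {k : ℕ} {S : Set V}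
    (hS : IsKTDS G k S) : kTotalDomNum G k ≤ S.ncard :=
  Nat.sInf_le ⟨S, hS, rfl⟩

/-- A union of `k` full columns dominates: a vertex `(i, j)` sees the entries of row `i` in the
other columns, and its own entry can be replaced by another entry of column `j`. -/
theorem isKTDS_univ_prod {α β : Type*} [Finite α] [Finite β] [Nontrivial α] (T : Set β) :
    IsKTDS ((⊤ : SimpleGraph α) □ (⊤ : SimpleGraph β)) T.ncard (univ ×ˢ T) := by
  classical
  rintro ⟨i, j⟩
  obtain ⟨i', hi'⟩ := exists_ne i
  refine ncard_le_ncard_of_injOn (fun c => if c = j then (i', c) else (i, c)) ?_ ?_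
    (Set.toFinite _)
  · intro c hc
    by_cases h : c = j
    · subst h
      simp [hc, boxProd_adj, hi'.symm]
    · simp [hc, h, boxProd_adj, Ne.symm h]
  · intro c _ d _ hcd
    have hsnd (x : β) : (if x = j then (i', x) else (i, x)).2 = x := by split_ifs <;> rfl
    simpa only [hsnd] using congrArg Prod.snd hcd

theorem ktdn_rook_le_kn (n m k : ℕ) (hk : 1 ≤ k) (hn : 2 ≤ n) (hnm : n ≤ m)
    (hkm : k ≤ m) :
    kTotalDomNum ((⊤ : SimpleGraph (Fin n)) □ (⊤ : SimpleGraph (Fin m))) k ≤ k * n := by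
  have : Nontrivial (Fin n) := Fin.nontrivial_iff_two_le.mpr hn
  obtain ⟨T, -, hT⟩ := Set.exists_subset_card_eq (s := (univ : Set (Fin m))) (n := k)
    (by simpa [ncard_univ] using hkm)
  subst hT
  refine (kTotalDomNum_le_ncard (isKTDS_univ_prod T)).trans_eq ?_
  rw [ncard_prod, ncard_univ, Nat.card_fin, mul_comm]
end

section
/- Let n, m be integers with m ≥ n ≥ 1 and (n,m) ∉ {(1,1),(1,2)}. Then γ_{×2,t}(K_n □ K_m) equals: 3 if n = 1 and m ≥ 3; 2n if n ≥ 2 and m ≥ ⌊(5n−4)/3⌋ + 1; ⌈3(n+m)/4⌉ + 1 if n ≥ 2, m ≤ ⌊(5n−4)/3⌋ and m ≡ 3n + 4 (mod 8); and ⌈3(n+m)/4⌉ if n ≥ 2, m ≤ ⌊(5n−4)/3⌋ and m ≢ 3n + 4 (mod 8). -/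
open SimpleGraph Set

/-- If every fiber of `f` on `s` is nonempty, weighting each element of `s` by the inverse of the
size of its fiber counts the codomain. -/
theorem sum_inv_card_fiber {ι α : Type*} [Fintype α] [DecidableEq α] (s : Finset ι) (f : ι → α)
    (h : ∀ a, 1 ≤ (s.filter fun p => f p = a).card) :
    ∑ p ∈ s, ((s.filter fun q => f q = f p).card : ℚ)⁻¹ = Fintype.card α := by
  rw [← Finset.sum_fiberwise s f]
  have key : ∀ a, ∑ p ∈ s.filter (fun p => f p = a),
      ((s.filter fun q => f q = f p).card : ℚ)⁻¹ = 1 := by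
    intro a
    have ha : ((s.filter fun p => f p = a).card : ℚ) ≠ 0 := by
      have := h a
      positivity
    rw [Finset.sum_congr rfl (g := fun _ => ((s.filter fun q => f q = a).card : ℚ)⁻¹)]
    · rw [Finset.sum_const, nsmul_eq_mul, mul_inv_cancel₀ ha]
    · intro p hp
      rw [(Finset.mem_filter.1 hp).2]
  simp [key]

theorem inv_add_inv_le_four_thirds {r c : ℕ} (hr : 1 ≤ r) (hc : 1 ≤ c) (h : 4 ≤ r + c) :
    (r : ℚ)⁻¹ + (c : ℚ)⁻¹ ≤ 4 / 3 := by
  have hr' : (1 : ℚ) ≤ r := by exact_mod_cast hr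
  have hc' : (1 : ℚ) ≤ c := by exact_mod_cast hc
  have h' : (4 : ℚ) ≤ r + c := by exact_mod_cast h
  rw [inv_add_inv (by positivity) (by positivity), div_le_div_iff₀ (by positivity) (by norm_num)]
  nlinarith [mul_nonneg (sub_nonneg.2 hr') (sub_nonneg.2 hc')]

theorem eq_one_three_of_inv_add_inv {r c : ℕ} (hr : 1 ≤ r) (hc : 1 ≤ c) (h : 4 ≤ r + c)
    (he : (r : ℚ)⁻¹ + (c : ℚ)⁻¹ = 4 / 3) : (r = 1 ∧ c = 3) ∨ (r = 3 ∧ c = 1) := by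
  have he' : 3 * (r + c) = 4 * (r * c) := by
    have hr' : (r : ℚ) ≠ 0 := by positivity
    have hc' : (c : ℚ) ≠ 0 := by positivity
    field_simp at he
    have : (3 * (r + c) : ℚ) = 4 * (r * c) := by linarith
    exact_mod_cast this
  obtain ⟨x, rfl⟩ := Nat.exists_eq_add_of_le hr
  obtain ⟨y, rfl⟩ := Nat.exists_eq_add_of_le hc
  have h0 : x * y = 0 := by nlinarith [Nat.zero_le (x * y)]
  rcases Nat.mul_eq_zero.1 h0 with rfl | rfl <;> omega

section BipartiteEdges

variable {α β : Type*} [Fintype α] [DecidableEq α] [Fintype β] [DecidableEq β] (s : Finset (α × β))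

theorem three_mul_card_add_card_le
    (hr : ∀ a, 1 ≤ (s.filter fun p => p.1 = a).card)
    (hc : ∀ b, 1 ≤ (s.filter fun p => p.2 = b).card)
    (h : ∀ p ∈ s, 4 ≤ (s.filter fun q => q.1 = p.1).card + (s.filter fun q => q.2 = p.2).card) :
    3 * (Fintype.card α + Fintype.card β) ≤ 4 * s.card := by
  have key := Finset.sum_le_sum fun p hp =>
    inv_add_inv_le_four_thirds (hr (p : α × β).1) (hc p.2) (h p hp)
  rw [Finset.sum_add_distrib, sum_inv_card_fiber s Prod.fst hr, sum_inv_card_fiber s Prod.snd hc,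
    Finset.sum_const, nsmul_eq_mul] at key
  have : (3 * (Fintype.card α + Fintype.card β) : ℚ) ≤ 4 * s.card := by linarith
  exact_mod_cast this

theorem eight_dvd_of_three_mul_card_add_card_eq
    (hr : ∀ a, 1 ≤ (s.filter fun p => p.1 = a).card)
    (hc : ∀ b, 1 ≤ (s.filter fun p => p.2 = b).card)
    (h : ∀ p ∈ s, 4 ≤ (s.filter fun q => q.1 = p.1).card + (s.filter fun q => q.2 = p.2).card)
    (he : 3 * (Fintype.card α + Fintype.card β) = 4 * s.card) :
    (8 : ℤ) ∣ 3 * Fintype.card α - Fintype.card β := by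
  have hα := sum_inv_card_fiber s Prod.fst hr
  have hβ := sum_inv_card_fiber s Prod.snd hc
  have heq : ∑ p ∈ s, (((s.filter fun q => q.1 = p.1).card : ℚ)⁻¹ +
      ((s.filter fun q => q.2 = p.2).card : ℚ)⁻¹) = ∑ p ∈ s, (4 / 3 : ℚ) := by
    rw [Finset.sum_add_distrib, hα, hβ, Finset.sum_const, nsmul_eq_mul]
    have : (3 * (Fintype.card α + Fintype.card β) : ℚ) = 4 * s.card := by exact_mod_cast he
    linarith
  rw [Finset.sum_eq_sum_iff_of_le fun p hp =>
    inv_add_inv_le_four_thirds (hr p.1) (hc p.2) (h p hp)] at heq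
  have hterm : ∀ p ∈ s, 3 * ((s.filter fun q => q.1 = p.1).card : ℚ)⁻¹ -
      ((s.filter fun q => q.2 = p.2).card : ℚ)⁻¹ =
      if (s.filter fun q => q.1 = p.1).card = 1 then 8 / 3 else 0 := by
    intro p hp
    rcases eq_one_three_of_inv_add_inv (hr p.1) (hc p.2) (h p hp) (heq p hp) with
      ⟨h1, h2⟩ | ⟨h1, h2⟩ <;> rw [h1, h2] <;> norm_num
  have hsum := Finset.sum_congr rfl hterm
  rw [Finset.sum_sub_distrib, ← Finset.mul_sum, hα, hβ, ← Finset.sum_filter, Finset.sum_const,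
    nsmul_eq_mul] at hsum
  set e := (s.filter fun p => (s.filter fun q => q.1 = p.1).card = 1).card
  have hZ : 3 * (3 * (Fintype.card α : ℤ) - Fintype.card β) = 8 * e := by
    have : 3 * (3 * (Fintype.card α : ℚ) - Fintype.card β) = 8 * e := by linarith
    exact_mod_cast this
  omega

end BipartiteEdges

theorem IsKTDS.lt_ncard {V : Type*} [Finite V] [Nonempty V] {G : SimpleGraph V} {k : ℕ} {S : Set V}
    (hk : 1 ≤ k) (hS : IsKTDS G k S) : k < S.ncard := by
  obtain ⟨v⟩ := ‹Nonempty V›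
  have hne : (S ∩ G.neighborSet v).Nonempty :=
    Set.nonempty_of_ncard_ne_zero (Nat.one_le_iff_ne_zero.1 (hk.trans (hS v)))
  obtain ⟨w, hw, -⟩ := hne
  refine (hS w).trans_lt (Set.ncard_lt_ncard ?_)
  exact (Set.ssubset_iff_of_subset Set.inter_subset_left).2 ⟨w, hw, fun h => G.irrefl h.2⟩

theorem kTotalDomNum_le {V : Type*} [Fintype V] {G : SimpleGraph V} {k N : ℕ} {S : Set V}
    (hS : IsKTDS G k S) (hN : S.ncard ≤ N) : kTotalDomNum G k ≤ N := by
  refine le_trans (Nat.sInf_le ?_) hN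
  exact ⟨S, hS, rfl⟩

theorem le_kTotalDomNum {V : Type*} [Fintype V] {G : SimpleGraph V} {k N : ℕ}
    (hne : ∃ S, IsKTDS G k S) (h : ∀ S, IsKTDS G k S → N ≤ S.ncard) : N ≤ kTotalDomNum G k := by
  obtain ⟨S, hS⟩ := hne
  refine le_csInf ⟨S.ncard, S, hS, rfl⟩ ?_
  rintro _ ⟨T, hT, rfl⟩
  exact h T hT

section Rook

variable {n m : ℕ}

/-- The `n × m` rook graph. -/
abbrev rookGraph (n m : ℕ) : SimpleGraph (Fin n × Fin m) :=
  (⊤ : SimpleGraph (Fin n)) □ (⊤ : SimpleGraph (Fin m))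

theorem rook_neighborSet_inter_subset (s : Finset (Fin n × Fin m)) (v : Fin n × Fin m) :
    (s : Set (Fin n × Fin m)) ∩ (rookGraph n m).neighborSet v ⊆
      ((s.filter fun q => q.1 = v.1).erase v ∪ (s.filter fun q => q.2 = v.2).erase v : Finset _) := by
  rintro w ⟨hw, hadj⟩
  rw [SimpleGraph.mem_neighborSet] at hadj
  have hne : w ≠ v := hadj.ne'
  rw [SimpleGraph.boxProd_adj] at hadj
  simp only [Finset.coe_union, Finset.coe_erase, Set.mem_union, Set.mem_sdiff, Finset.mem_coe,
    Finset.mem_filter, Set.mem_singleton_iff]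
  rcases hadj with ⟨-, h⟩ | ⟨-, h⟩
  · exact Or.inr ⟨⟨hw, h.symm⟩, hne⟩
  · exact Or.inl ⟨⟨hw, h.symm⟩, hne⟩

theorem IsKTDS.rook_le_card_add_card {k : ℕ} {s : Finset (Fin n × Fin m)} (hS : IsKTDS (rookGraph n m) k s)
    (v : Fin n × Fin m) :
    k ≤ ((s.filter fun q => q.1 = v.1).erase v).card +
      ((s.filter fun q => q.2 = v.2).erase v).card := by
  refine (hS v).trans (le_trans ?_ (Finset.card_union_le _ _))
  rw [← Set.ncard_coe_finset]
  exact Set.ncard_le_ncard (rook_neighborSet_inter_subset s v) (Finset.finite_toSet _)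

theorem IsKTDS.rook_card {s : Finset (Fin n × Fin m)} (hS : IsKTDS (rookGraph n m) 2 s) :
    2 * m ≤ s.card ∨ 2 * n ≤ s.card ∨ (3 * (n + m) ≤ 4 * s.card ∧
      (3 * (n + m) = 4 * s.card → (8 : ℤ) ∣ 3 * n - m)) := by
  have hout (v : Fin n × Fin m) : 2 ≤ (s.filter fun q => q.1 = v.1).card + (s.filter fun q => q.2 = v.2).card :=
    (hS.rook_le_card_add_card v).trans
      (add_le_add (Finset.card_erase_le) (Finset.card_erase_le))
  by_cases hr : ∀ a, 1 ≤ (s.filter fun p => p.1 = a).card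
  · by_cases hc : ∀ b, 1 ≤ (s.filter fun p => p.2 = b).card
    · have h4 : ∀ p ∈ s, 4 ≤ (s.filter fun q => q.1 = p.1).card +
          (s.filter fun q => q.2 = p.2).card := by
        intro p hp
        have := hS.rook_le_card_add_card p
        rw [Finset.card_erase_of_mem (by simp [hp]), Finset.card_erase_of_mem (by simp [hp])] at this
        have := hr p.1
        have := hc p.2
        omega
      have hle := three_mul_card_add_card_le s hr hc h4
      have heq := eight_dvd_of_three_mul_card_add_card_eq s hr hc h4
      simp only [Fintype.card_fin] at hle heq
      exact Or.inr (Or.inr ⟨hle, heq⟩)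
    · push Not at hc
      obtain ⟨b, hb⟩ := hc
      refine Or.inr (Or.inl ?_)
      have := Finset.mul_card_image_le_card_of_maps_to (s := s) (t := Finset.univ) (f := Prod.fst)
        (fun _ _ => Finset.mem_univ _) 2 (fun a _ => by have := hout (a, b); simp only at this; omega)
      simpa using this
  · push Not at hr
    obtain ⟨a, ha⟩ := hr
    refine Or.inl ?_
    have := Finset.mul_card_image_le_card_of_maps_to (s := s) (t := Finset.univ) (f := Prod.snd)
      (fun _ _ => Finset.mem_univ _) 2 (fun b _ => by have := hout (a, b); simp only at this; omega)
    simpa using this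

theorem two_le_ncard_inter_neighborSet {S : Set (Fin n × Fin m)} {v x y : Fin n × Fin m}
    (hx : x ∈ S) (hy : y ∈ S) (hxy : x ≠ y) (hvx : (rookGraph n m).Adj v x)
    (hvy : (rookGraph n m).Adj v y) :
    2 ≤ (S ∩ (rookGraph n m).neighborSet v).ncard := by
  rw [← Set.ncard_pair hxy]
  refine Set.ncard_le_ncard ?_ (Set.toFinite _)
  rintro z (rfl | rfl)
  exacts [⟨hx, hvx⟩, ⟨hy, hvy⟩]

theorem rook_two_le_of_row {S : Set (Fin n × Fin m)} {i : Fin n} {j x y z : Fin m}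
    (hx : (i, x) ∈ S) (hy : (i, y) ∈ S) (hz : (i, z) ∈ S) (hxy : x ≠ y) (hxz : x ≠ z)
    (hyz : y ≠ z) : 2 ≤ (S ∩ (rookGraph n m).neighborSet (i, j)).ncard := by
  by_cases h1 : j = x
  · subst h1
    apply two_le_ncard_inter_neighborSet hy hz <;> simp_all [SimpleGraph.boxProd_adj]
  by_cases h2 : j = y
  · subst h2
    apply two_le_ncard_inter_neighborSet hx hz <;> simp_all [SimpleGraph.boxProd_adj]
  apply two_le_ncard_inter_neighborSet hx hy <;> simp_all [SimpleGraph.boxProd_adj]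

theorem rook_two_le_of_col {S : Set (Fin n × Fin m)} {j : Fin m} {i x y z : Fin n}
    (hx : (x, j) ∈ S) (hy : (y, j) ∈ S) (hz : (z, j) ∈ S) (hxy : x ≠ y) (hxz : x ≠ z)
    (hyz : y ≠ z) : 2 ≤ (S ∩ (rookGraph n m).neighborSet (i, j)).ncard := by
  by_cases h1 : i = x
  · subst h1
    apply two_le_ncard_inter_neighborSet hy hz <;> simp_all [SimpleGraph.boxProd_adj]
  by_cases h2 : i = y
  · subst h2
    apply two_le_ncard_inter_neighborSet hx hz <;> simp_all [SimpleGraph.boxProd_adj]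
  apply two_le_ncard_inter_neighborSet hx hy <;> simp_all [SimpleGraph.boxProd_adj]

theorem rook_two_le_of_corner {S : Set (Fin n × Fin m)} {i x : Fin n} {j y : Fin m}
    (hx : (x, j) ∈ S) (hy : (i, y) ∈ S) (hix : i ≠ x) (hjy : j ≠ y) :
    2 ≤ (S ∩ (rookGraph n m).neighborSet (i, j)).ncard := by
  apply two_le_ncard_inter_neighborSet hx hy <;>
    simp [SimpleGraph.boxProd_adj, hix, hjy, Ne.symm hix]

theorem ncard_setOf_snd_lt (w : ℕ) (hw : w ≤ m) :
    {p : Fin n × Fin m | p.2.val < w}.ncard = n * w := by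
  have : {p : Fin n × Fin m | p.2.val < w} = Set.univ ×ˢ {j : Fin m | j.val < w} := by
    ext; simp
  rw [this, Set.ncard_prod, Set.ncard_univ, Nat.card_fin, Set.ncard_eq_toFinset_card']
  congr 1
  simpa [hw] using Fin.card_filter_val_lt (n := m) (m := w)

theorem isKTDS_two_columns (hn : 2 ≤ n) (hm : 2 ≤ m) :
    IsKTDS (rookGraph n m) 2 {p : Fin n × Fin m | p.2.val < 2} := by
  rintro ⟨i, j⟩
  by_cases hj : j.val < 2
  · have : ∃ x : Fin n, i ≠ x := by
      have : Nontrivial (Fin n) := Fin.nontrivial_iff_two_le.2 hn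
      obtain ⟨x, hx⟩ := exists_ne i
      exact ⟨x, hx.symm⟩
    obtain ⟨x, hx⟩ := this
    refine rook_two_le_of_corner (x := x) (y := ⟨1 - j.val, by omega⟩) hj ?_ hx ?_
    · simp only [Set.mem_ofPred_eq]; omega
    · simp only [ne_eq, Fin.ext_iff]; omega
  · apply two_le_ncard_inter_neighborSet (x := (i, ⟨0, by omega⟩)) (y := (i, ⟨1, by omega⟩)) <;>
      simp [SimpleGraph.boxProd_adj, Fin.ext_iff] <;> omega

theorem isKTDS_three_columns (hm : 3 ≤ m) :
    IsKTDS (rookGraph n m) 2 {p : Fin n × Fin m | p.2.val < 3} := by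
  rintro ⟨i, j⟩
  apply rook_two_le_of_row (x := ⟨0, by omega⟩) (y := ⟨1, by omega⟩) (z := ⟨2, by omega⟩) <;>
    simp

/-- The edge set of a disjoint union of `a` stars centered at the first `a` rows and `b` stars
centered at the first `b` columns, spanning all rows and columns. -/
def starForest (n m a b : ℕ) : Set (Fin n × Fin m) :=
  {p | (a ≤ p.1.val ∧ p.2.val = (p.1.val - a) % b) ∨ (b ≤ p.2.val ∧ p.1.val = (p.2.val - b) % a)}

theorem ncard_setOf_le_val (a : ℕ) : {i : Fin n | a ≤ i.val}.ncard = n - a := by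
  rw [Set.ncard_eq_toFinset_card']
  have := Finset.card_filter_add_card_filter_not (s := (Finset.univ : Finset (Fin n)))
    (fun i : Fin n => i.val < a)
  simp only [not_lt, Finset.card_univ, Fintype.card_fin, Fin.card_filter_val_lt] at this
  simp only [Set.toFinset_ofPred]
  omega

theorem ncard_starForest_le (a b : ℕ) : (starForest n m a b).ncard ≤ (n - a) + (m - b) := by
  refine (Set.ncard_union_le _ _).trans (add_le_add ?_ ?_)
  · rw [← ncard_setOf_le_val a]
    refine Set.ncard_le_ncard_of_injOn Prod.fst (fun p hp => hp.1) ?_ (Set.toFinite _)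
    rintro ⟨i, j⟩ hp ⟨i', j'⟩ hp' (rfl : i = i')
    exact Prod.ext rfl (Fin.ext (hp.2.trans hp'.2.symm))
  · rw [← ncard_setOf_le_val b]
    refine Set.ncard_le_ncard_of_injOn Prod.snd (fun p hp => hp.1) ?_ (Set.toFinite _)
    rintro ⟨i, j⟩ hp ⟨i', j'⟩ hp' (rfl : j = j')
    exact Prod.ext (Fin.ext (hp.2.trans hp'.2.symm)) rfl

theorem isKTDS_starForest {a b : ℕ} (ha : 1 ≤ a) (hb : 1 ≤ b) (hn : a + 3 * b ≤ n)
    (hm : 3 * a + b ≤ m) : IsKTDS (rookGraph n m) 2 (starForest n m a b) := by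
  rintro ⟨i, j⟩
  by_cases hi : i.val < a
  · have hrow : ∀ t, t < 3 → ∀ h : b + (i.val + a * t) < m,
        (i, (⟨b + (i.val + a * t), h⟩ : Fin m)) ∈ starForest n m a b := by
      intro t _ h
      refine Or.inr ⟨by simp, ?_⟩
      simp [Nat.mod_eq_of_lt hi]
    apply rook_two_le_of_row (hrow 0 (by omega) (by omega)) (hrow 1 (by omega) (by omega))
      (hrow 2 (by omega) (by omega)) <;> simp [Fin.ext_iff] <;> omega
  by_cases hj : j.val < b
  · have hcol : ∀ t, t < 3 → ∀ h : a + (j.val + b * t) < n,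
        ((⟨a + (j.val + b * t), h⟩ : Fin n), j) ∈ starForest n m a b := by
      intro t _ h
      refine Or.inl ⟨by simp, ?_⟩
      simp [Nat.mod_eq_of_lt hj]
    apply rook_two_le_of_col (hcol 0 (by omega) (by omega)) (hcol 1 (by omega) (by omega))
      (hcol 2 (by omega) (by omega)) <;> simp [Fin.ext_iff] <;> omega
  · have h1 := Nat.mod_lt (i.val - a) hb
    have h2 := Nat.mod_lt (j.val - b) ha
    refine rook_two_le_of_corner (x := ⟨(j.val - b) % a, by omega⟩)
      (y := ⟨(i.val - a) % b, by omega⟩) (Or.inr ⟨by simpa using hj, rfl⟩)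
      (Or.inl ⟨by simpa using hi, rfl⟩) ?_ ?_ <;> simp only [ne_eq, Fin.ext_iff] <;> omega

end Rook

/-- The first row together with the first column is a double star. -/
theorem isKTDS_cross :
    IsKTDS (rookGraph 3 3) 2 {p | p.1 = 0 ∨ p.2 = 0} := by
  rintro ⟨i, j⟩
  by_cases hi : i = 0
  · subst hi
    apply rook_two_le_of_row (x := 0) (y := 1) (z := 2) <;> simp
  by_cases hj : j = 0
  · subst hj
    apply rook_two_le_of_col (x := 0) (y := 1) (z := 2) <;> simp
  exact rook_two_le_of_corner (x := 0) (y := 0) (by simp) (by simp) hi hj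

theorem ncard_cross : {p : Fin 3 × Fin 3 | p.1 = 0 ∨ p.2 = 0}.ncard = 5 := by
  rw [Set.ncard_eq_toFinset_card']
  decide

theorem exists_star_counts {n m k : ℕ} (hk : 2 ≤ k) (hnm : n ≤ m) (hkn : k + 2 ≤ n)
    (hle : 4 * k ≤ n + m) (hpar : 4 * k = n + m → (n + k) % 2 = 0) :
    ∃ a b, 1 ≤ a ∧ 1 ≤ b ∧ a + 3 * b ≤ n ∧ 3 * a + b ≤ m ∧ a + b = k := by
  by_cases h : 3 * k ≤ m + 2
  · exact ⟨k - 1, 1, by omega, by omega, by omega, by omega, by omega⟩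
  · refine ⟨k - (3 * k - m + 1) / 2, (3 * k - m + 1) / 2, ?_, ?_, ?_, ?_, ?_⟩ <;> omega

theorem kTotalDomNum_rook_le {n m k : ℕ} (hk : 2 ≤ k) (hnm : n ≤ m) (hkn : k + 2 ≤ n)
    (hle : 4 * k ≤ n + m) (hpar : 4 * k = n + m → (n + k) % 2 = 0) :
    kTotalDomNum (rookGraph n m) 2 ≤ n + m - k := by
  obtain ⟨a, b, ha, hb, han, hbm, hab⟩ := exists_star_counts hk hnm hkn hle hpar
  refine kTotalDomNum_le (isKTDS_starForest ha hb han hbm)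
    ((ncard_starForest_le a b).trans (by omega))

theorem floor_five_mul_sub_four_div_three_lt {n m : ℕ} (hn : 1 ≤ n) :
    ⌊(5 * (n : ℚ) - 4) / 3⌋₊ + 1 ≤ m ↔ 5 * n < 3 * m + 4 := by
  have hn' : (1 : ℚ) ≤ n := by exact_mod_cast hn
  rw [Nat.add_one_le_iff, Nat.floor_lt (by linarith), div_lt_iff₀ (by norm_num), sub_lt_iff_lt_add,
    mul_comm (m : ℚ)]
  exact_mod_cast Iff.rfl

theorem ceil_three_mul_div_four (n m : ℕ) :
    ⌈(3 * ((n : ℚ) + m)) / 4⌉₊ = (3 * (n + m) + 3) / 4 := by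
  refine eq_of_forall_ge_iff fun c => ?_
  rw [Nat.ceil_le, div_le_iff₀ (by norm_num)]
  have : (3 * ((n : ℚ) + m) ≤ c * 4) ↔ 3 * (n + m) ≤ c * 4 := by exact_mod_cast Iff.rfl
  rw [this]
  omega

theorem two_tuple_total_domination_rook (n m : ℕ) (hn : 1 ≤ n) (hnm : n ≤ m)
    (h1 : (n, m) ≠ (1, 1)) (h2 : (n, m) ≠ (1, 2)) :
    kTotalDomNum ((⊤ : SimpleGraph (Fin n)) □ (⊤ : SimpleGraph (Fin m))) 2 =
      if n = 1 then 3
      else if ⌊(5 * (n : ℚ) - 4) / 3⌋₊ + 1 ≤ m then 2 * n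
      else if m % 8 = (3 * n + 4) % 8 then ⌈(3 * ((n : ℚ) + m)) / 4⌉₊ + 1
      else ⌈(3 * ((n : ℚ) + m)) / 4⌉₊ := by
  change kTotalDomNum (rookGraph n m) 2 = _
  have hcard : ∀ S, IsKTDS (rookGraph n m) 2 S →
      2 * n ≤ S.ncard ∨ (3 * (n + m) ≤ 4 * S.ncard ∧
        (3 * (n + m) = 4 * S.ncard → (8 : ℤ) ∣ 3 * n - m)) := by
    intro S hS
    obtain ⟨s, rfl⟩ := S.toFinite.exists_finset_coe
    rw [Set.ncard_coe_finset]
    have := hS.rook_card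
    omega
  simp only [floor_five_mul_sub_four_div_three_lt hn, ceil_three_mul_div_four]
  split_ifs with hn1 hm hmod
  · subst hn1
    have hm3 : 3 ≤ m := by
      simp only [ne_eq, Prod.mk.injEq, true_and] at h1 h2
      omega
    have : NeZero m := ⟨by omega⟩
    refine le_antisymm (kTotalDomNum_le (isKTDS_three_columns hm3)
      (by simp [ncard_setOf_snd_lt 3 hm3])) ?_
    exact le_kTotalDomNum ⟨_, isKTDS_three_columns hm3⟩ fun S hS => hS.lt_ncard one_le_two
  all_goals
    have htwo := isKTDS_two_columns (n := n) (m := m) (by omega) (by omega)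
    have htwo_le := kTotalDomNum_le htwo (ncard_setOf_snd_lt 2 (by omega)).le
    refine le_antisymm ?_ (le_kTotalDomNum ⟨_, htwo⟩ fun S hS => ?_)
  · omega
  · have := hcard S hS
    omega
  · by_cases hsmall : n ≤ 4
    · refine htwo_le.trans ?_
      interval_cases n <;> omega
    · refine (kTotalDomNum_rook_le (k := (n + m) / 4 - 1) ?_ hnm ?_ ?_ ?_).trans ?_ <;> omega
  · have := hcard S hS
    omega
  · by_cases hsmall : n ≤ 3
    · obtain rfl : n = 3 := by omega
      obtain rfl : m = 3 := by omega
      exact kTotalDomNum_le isKTDS_cross ncard_cross.le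
    · refine (kTotalDomNum_rook_le (k := (n + m) / 4) ?_ hnm ?_ ?_ ?_).trans ?_ <;> omega
  · have := hcard S hS
    omega
end
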